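/- Let (X, 𝓑, μ, f) be a dissipative system of bounded distortion generated by W, with f bijective and both f and f⁻¹ satisfying condition (⋆), and let 1 ≤ p < ∞. If the composition operator T_f on L^p(X, μ) has the shadowing property, then at least one of the following three conditions holds: (𝓗𝓒) limsup_{n→∞} sup_{k∈ℤ} (μ(f^k(W))/μ(f^{k+n}(W)))^{1/n} < 1; (𝓗𝓓) liminf_{n→∞} inf_{k∈ℤ} (μ(f^k(W))/μ(f^{k+n}(W)))^{1/n} > 1; (𝓖𝓗) limsup_{n→∞} sup_{k≤0} (μ(f^{k−n}(W))/μ(f^k(W)))^{1/n} < 1 and liminf_{n→∞} inf_{k≥0} (μ(f^k(W))/μ(f^{k+n}(W)))^{1/n} > 1. -/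

import Mathlib

open MeasureTheory Filter Set Function Topology ENNReal

noncomputable section

namespace GHShadow

/-- The shadowing property for an invertible bounded linear operator. -/
def HasShadowing {E : Type*} [NormedAddCommGroup E] [NormedSpace ℝ E]
    (T : E ≃L[ℝ] E) : Prop :=
  ∀ ε : ℝ, 0 < ε → ∃ δ : ℝ, 0 < δ ∧ ∀ x : ℤ → E,
    (∀ n : ℤ, ‖T (x n) - x (n + 1)‖ ≤ δ) →
      ∃ y : E, ∀ n : ℤ, ‖(T ^ n) y - x n‖ < ε

/-- `lim ‖Tⁿ‖^{1/n}` exists and is `< 1`. -/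
def SpectralRadiusLtOne {E : Type*} [NormedAddCommGroup E] [NormedSpace ℝ E]
    (T : E →L[ℝ] E) : Prop :=
  ∃ r : ℝ, r < 1 ∧ Tendsto (fun n : ℕ => ‖T ^ n‖ ^ (1 / (n : ℝ))) atTop (nhds r)

/-- The restriction of `T` to `M` has spectral radius `< 1`
(equivalently, is a proper contraction in an equivalent norm). -/
def ContractsOn {E : Type*} [NormedAddCommGroup E] [NormedSpace ℝ E]
    (T : E ≃L[ℝ] E) (M : Submodule ℝ E) : Prop :=
  ∃ C : ℝ, 0 < C ∧ ∃ t : ℝ, 0 < t ∧ t < 1 ∧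
    ∀ n : ℕ, ∀ x ∈ M, ‖(T ^ n) x‖ ≤ C * t ^ n * ‖x‖

def GeneralizedHyperbolic {E : Type*} [NormedAddCommGroup E] [NormedSpace ℝ E]
    (T : E ≃L[ℝ] E) : Prop :=
  ∃ M N : Submodule ℝ E, IsClosed (M : Set E) ∧ IsClosed (N : Set E) ∧
    IsCompl M N ∧ (∀ x ∈ M, T x ∈ M) ∧ (∀ x ∈ N, T.symm x ∈ N) ∧
    ContractsOn T M ∧ ContractsOn T.symm N

variable {X : Type*} [MeasurableSpace X]

/-- image of `B` under the `k`-th iterate of the invertible map `f`. -/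
def img (f : Equiv.Perm X) (k : ℤ) (B : Set X) : Set X := ⇑(f ^ k) '' B

/-- `(X, 𝓑, μ, f)` is a dissipative system generated by `W`. -/
structure IsDissipative (μ : Measure X) (f : Equiv.Perm X) (W : Set X) : Prop where
  sigmaFin : SigmaFinite μ
  meas_f : Measurable f
  meas_symm : Measurable f.symm
  meas_W : MeasurableSet W
  pos : 0 < μ W
  fin : μ W < ⊤
  disj : Pairwise fun k l : ℤ => Disjoint (img f k W) (img f l W)
  cover : (⋃ k : ℤ, img f k W) = univ

/-- `f` is of bounded distortion on `W` with constant `K`. -/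
def BoundedDistortion (μ : Measure X) (f : Equiv.Perm X) (W : Set X) (K : ℝ≥0∞) : Prop :=
  ∀ k : ℤ, ∀ B : Set X, MeasurableSet B → B ⊆ W →
    (1 / K) * (μ (img f k W) * μ B) ≤ μ (img f k B) * μ W ∧
      μ (img f k B) * μ W ≤ K * (μ (img f k W) * μ B)

/-- condition (⋆) for a transformation `g`. -/
def CondStar (μ : Measure X) (g : X → X) : Prop :=
  ∃ c : ℝ≥0∞, 0 < c ∧ c ≠ ⊤ ∧ ∀ B : Set X, MeasurableSet B → μ (g ⁻¹' B) ≤ c * μ B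

/-- condition 𝓗𝓒. -/
def CondHC (μ : Measure X) (f : Equiv.Perm X) (W : Set X) : Prop :=
  limsup (fun n : ℕ =>
    ⨆ k : ℤ, (μ (img f k W) / μ (img f (k + (n : ℤ)) W)) ^ (1 / (n : ℝ))) atTop < 1

/-- condition 𝓗𝓓. -/
def CondHD (μ : Measure X) (f : Equiv.Perm X) (W : Set X) : Prop :=
  1 < liminf (fun n : ℕ =>
    ⨅ k : ℤ, (μ (img f k W) / μ (img f (k + (n : ℤ)) W)) ^ (1 / (n : ℝ))) atTop

/-- condition 𝓖𝓗. -/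
def CondGH (μ : Measure X) (f : Equiv.Perm X) (W : Set X) : Prop :=
  limsup (fun n : ℕ =>
      ⨆ m : ℕ, (μ (img f (-(m : ℤ) - (n : ℤ)) W) / μ (img f (-(m : ℤ)) W)) ^ (1 / (n : ℝ)))
      atTop < 1 ∧
  1 < liminf (fun n : ℕ =>
      ⨅ m : ℕ, (μ (img f (m : ℤ) W) / μ (img f ((m : ℤ) + (n : ℤ)) W)) ^ (1 / (n : ℝ))) atTop

/-- `T` represents the composition operator `φ ↦ φ ∘ f` on `L^p(X,μ)`. -/
def RepsComp (μ : Measure X) (p : ℝ≥0∞) [Fact (1 ≤ p)] (f : X → X)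
    (T : Lp ℝ p μ ≃L[ℝ] Lp ℝ p μ) : Prop :=
  ∀ φ : Lp ℝ p μ, ⇑(T φ) =ᵐ[μ] fun x => (φ : X → ℝ) (f x)


/-! ### Scalar difference equation -/

theorem exists_sub_succ_eq (b : ℤ → ℝ) : ∃ G : ℤ → ℝ, ∀ j, G j - G (j + 1) = b j := by
  refine ⟨fun j => ∑ i ∈ Finset.Ico j 0, b i - ∑ i ∈ Finset.Ico 0 j, b i, fun j => ?_⟩
  rcases lt_or_ge j 0 with hj | hj
  · have h1 : Finset.Ico j 0 = insert j (Finset.Ico (j + 1) 0) := by ext; simp; omega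
    have h2 : Finset.Ico 0 j = ∅ := by ext; simp; omega
    have h3 : Finset.Ico 0 (j + 1) = ∅ := by ext; simp; omega
    simp only [h1, h2, h3]
    rw [Finset.sum_insert (by simp)]
    simp
  · have h1 : Finset.Ico 0 (j + 1) = insert j (Finset.Ico 0 j) := by ext; simp; omega
    have h2 : Finset.Ico j 0 = ∅ := by ext; simp; omega
    have h3 : Finset.Ico (j + 1) 0 = ∅ := by ext; simp; omega
    simp only [h1, h2, h3]
    rw [Finset.sum_insert (by simp)]
    simp

section Scalar

variable {b g : ℤ → ℝ} {D : ℝ}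

theorem antitone_of_sub_succ (hb : ∀ j, 0 < b j) (hg : ∀ j, g j - g (j + 1) = b j) :
    Antitone g :=
  antitone_int_of_succ_le fun j => by linarith [hb j, hg j]

/-- Where the solution is nonpositive, the weight grows exponentially. -/
theorem growth_of_nonpos (hb : ∀ j, 0 < b j) (hg : ∀ j, g j - g (j + 1) = b j) (hD : 0 < D)
    (hgD : ∀ j, |g j| ≤ D * b j) {j : ℤ} (hj : g j ≤ 0) (n : ℕ) :
    b j ≤ (D + 1) * (D / (D + 1)) ^ n * b (j + n) := by
  have anti := antitone_of_sub_succ hb hg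
  have step : ∀ i, j ≤ i → -g i ≤ D / (D + 1) * -g (i + 1) := fun i hi => by
    have h1 := hgD i
    rw [abs_of_nonpos ((anti hi).trans hj)] at h1
    rw [div_mul_eq_mul_div, le_div_iff₀ (by linarith)]
    nlinarith [hg i]
  have iter : -g (j + 1) ≤ (D / (D + 1)) ^ n * -g (j + 1 + n) := by
    induction n with
    | zero => simp
    | succ n ih =>
      refine ih.trans ?_
      rw [pow_succ, mul_assoc]
      have := step (j + 1 + n) (by omega)
      push_cast
      rw [← add_assoc]
      gcongr
  have h2 : -g (j + 1 + n) ≤ (D + 1) * b (j + n) := by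
    have := neg_le_abs (g (j + n))
    have h3 := hg (j + n)
    have h4 := hgD (j + n)
    rw [add_right_comm] at h3
    linarith
  calc b j ≤ -g (j + 1) := by linarith [hg j]
    _ ≤ (D / (D + 1)) ^ n * -g (j + 1 + n) := iter
    _ ≤ (D / (D + 1)) ^ n * ((D + 1) * b (j + n)) := by gcongr
    _ = _ := by ring

/-- Where the solution is nonnegative, the weight decays exponentially. -/
theorem decay_of_nonneg (hb : ∀ j, 0 < b j) (hg : ∀ j, g j - g (j + 1) = b j) (hD : 0 < D)
    (hgD : ∀ j, |g j| ≤ D * b j) {j : ℤ} {n : ℕ} (hj : 0 ≤ g (j + n + 1)) :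
    b (j + n) ≤ (D + 1) * (D / (D + 1)) ^ n * b j := by
  have anti := antitone_of_sub_succ hb hg
  have step : ∀ i, i ≤ j + n → g (i + 1) ≤ D / (D + 1) * g i := fun i hi => by
    have h0 : 0 ≤ g (i + 1) := hj.trans (anti (by omega))
    have h1 := (le_abs_self _).trans (hgD i)
    rw [div_mul_eq_mul_div, le_div_iff₀ (by linarith)]
    nlinarith [hg i, hb i]
  have iter : ∀ m : ℕ, m ≤ n → g (j + m) ≤ (D / (D + 1)) ^ m * g j := by
    intro m hm
    induction m with
    | zero => simp
    | succ m ih =>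
      have := step (j + m) (by omega)
      push_cast
      rw [← add_assoc, pow_succ', mul_assoc]
      exact this.trans (by have := ih (by omega); gcongr)
  calc b (j + n) ≤ g (j + n) := by linarith [hg (j + n)]
    _ ≤ (D / (D + 1)) ^ n * g j := iter n le_rfl
    _ ≤ (D / (D + 1)) ^ n * ((D + 1) * b j) := by
      have := (le_abs_self _).trans (hgD j)
      gcongr
      linarith [hb j]
    _ = _ := by ring

/-- If the solution changes sign, the weight dominates constants, so every translate of the
solution is still dominated by the weight. -/
theorem exists_abs_sub_le_of_sign_change (hb : ∀ j, 0 < b j)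
    (hg : ∀ j, g j - g (j + 1) = b j) (hD : 0 < D) (hgD : ∀ j, |g j| ≤ D * b j)
    {i₁ i₂ : ℤ} (h₁ : 0 < g i₁) (h₂ : g i₂ < 0) (κ : ℝ) :
    ∃ D' : ℝ, 0 < D' ∧ ∀ j, |g j - κ| ≤ D' * b j := by
  have anti := antitone_of_sub_succ hb hg
  obtain ⟨β, hβ, hβb⟩ : ∃ β : ℝ, 0 < β ∧ ∀ j, β ≤ b j := by
    have hne : (Finset.Icc i₁ i₂).Nonempty :=
      Finset.nonempty_Icc.2 (le_of_not_gt fun h => by linarith [anti h.le])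
    obtain ⟨i, -, hi⟩ := Finset.exists_min_image _ b hne
    refine ⟨min (b i) (min (g i₁ / D) (-g i₂ / D)), ?_, fun j => ?_⟩
    · have := hb i
      have := neg_pos.2 h₂
      positivity
    · by_cases hj1 : j < i₁
      · refine (min_le_right _ _).trans ((min_le_left _ _).trans ?_)
        rw [div_le_iff₀' hD]
        exact (anti hj1.le).trans ((le_abs_self _).trans (hgD j))
      by_cases hj2 : i₂ < j
      · refine (min_le_right _ _).trans ((min_le_right _ _).trans ?_)
        rw [div_le_iff₀' hD]
        exact (neg_le_neg (anti hj2.le)).trans ((neg_le_abs _).trans (hgD j))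
      · exact (min_le_left _ _).trans (hi j (Finset.mem_Icc.2 ⟨not_lt.1 hj1, not_lt.1 hj2⟩))
  refine ⟨D + |κ| / β, by positivity, fun j => ?_⟩
  have h1 : |κ| ≤ |κ| / β * b j := by
    rw [div_mul_eq_mul_div, le_div_iff₀ hβ]
    exact mul_le_mul_of_nonneg_left (hβb j) (abs_nonneg _)
  have := abs_sub (g j) κ
  linarith [hgD j]

theorem div_add_one_mem (hD : 0 < D) : 0 < D / (D + 1) ∧ D / (D + 1) < 1 :=
  ⟨by positivity, by rw [div_lt_one (by linarith)]; linarith⟩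

theorem weight_trichotomy (hb : ∀ j, 0 < b j) (hg : ∀ j, g j - g (j + 1) = b j) (hD : 0 < D)
    (hgD : ∀ j, |g j| ≤ D * b j) :
    (∃ M t : ℝ, 0 < M ∧ 0 < t ∧ t < 1 ∧ ∀ (j : ℤ) (n : ℕ), b (j + n) ≤ M * t ^ n * b j) ∨
    (∃ M t : ℝ, 0 < M ∧ 0 < t ∧ t < 1 ∧ ∀ (j : ℤ) (n : ℕ), b j ≤ M * t ^ n * b (j + n)) ∨
    ((∃ M t : ℝ, 0 < M ∧ 0 < t ∧ t < 1 ∧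
        ∀ (j : ℤ) (n : ℕ), j + n ≤ 0 → b (j + n) ≤ M * t ^ n * b j) ∧
      ∃ M t : ℝ, 0 < M ∧ 0 < t ∧ t < 1 ∧
        ∀ (j : ℤ) (n : ℕ), 0 ≤ j → b j ≤ M * t ^ n * b (j + n)) := by
  have anti := antitone_of_sub_succ hb hg
  by_cases hpos : ∀ j, 0 ≤ g j
  · exact .inl ⟨D + 1, D / (D + 1), by linarith, (div_add_one_mem hD).1, (div_add_one_mem hD).2,
      fun j n => decay_of_nonneg hb hg hD hgD (hpos _)⟩
  by_cases hneg : ∀ j, g j ≤ 0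
  · exact .inr (.inl ⟨D + 1, D / (D + 1), by linarith, (div_add_one_mem hD).1,
      (div_add_one_mem hD).2, fun j n => growth_of_nonpos hb hg hD hgD (hneg _) n⟩)
  push Not at hpos hneg
  obtain ⟨i₂, h₂⟩ := hpos
  obtain ⟨i₁, h₁⟩ := hneg
  have translate (κ : ℝ) : ∀ j, (fun i => g i - κ) j - (fun i => g i - κ) (j + 1) = b j :=
    fun j => by simp [← hg j]
  refine .inr (.inr ⟨?_, ?_⟩)
  · obtain ⟨E, hE, hgE⟩ := exists_abs_sub_le_of_sign_change hb hg hD hgD h₁ h₂ (g 1)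
    exact ⟨E + 1, E / (E + 1), by linarith, (div_add_one_mem hE).1, (div_add_one_mem hE).2,
      fun j n hj => decay_of_nonneg hb (translate (g 1)) hE hgE
        (sub_nonneg.2 (anti (by omega)))⟩
  · obtain ⟨E, hE, hgE⟩ := exists_abs_sub_le_of_sign_change hb hg hD hgD h₁ h₂ (g 0)
    exact ⟨E + 1, E / (E + 1), by linarith, (div_add_one_mem hE).1, (div_add_one_mem hE).2,
      fun j n hj => growth_of_nonpos hb (translate (g 0)) hE hgE (sub_nonpos.2 (anti hj)) n⟩

end Scalar

/-! ### From exponential bounds to root asymptotics -/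

theorem tendsto_ofReal_root {M t : ℝ} (hM : 0 < M) (ht : 0 < t) :
    Tendsto (fun n : ℕ => ENNReal.ofReal (M * t ^ n) ^ (1 / (n : ℝ))) atTop
      (𝓝 (ENNReal.ofReal t)) := by
  have h1 : Tendsto (fun n : ℕ => M ^ (1 / (n : ℝ)) * t) atTop (𝓝 t) := by
    have h := (tendsto_const_nhds (x := M)).rpow (tendsto_one_div_atTop_nhds_zero_nat (𝕜 := ℝ))
      (.inl hM.ne')
    simpa using h.mul_const t
  refine ((ENNReal.tendsto_ofReal h1).congr' ?_)
  filter_upwards [eventually_ne_atTop 0] with n hn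
  rw [ENNReal.ofReal_rpow_of_pos (by positivity), Real.mul_rpow hM.le (by positivity),
    ← Real.rpow_natCast t n, ← Real.rpow_mul ht.le, mul_one_div_cancel (by exact_mod_cast hn),
    Real.rpow_one]

theorem limsup_iSup_root_lt_one {ι : Type*} {F : ℕ → ι → ℝ≥0∞} {M t : ℝ} (hM : 0 < M)
    (ht : 0 < t) (ht1 : t < 1) (h : ∀ n i, F n i ≤ ENNReal.ofReal (M * t ^ n)) :
    limsup (fun n : ℕ => ⨆ i, F n i ^ (1 / (n : ℝ))) atTop < 1 := by
  refine lt_of_le_of_lt (b := ENNReal.ofReal t) ?_ (by simpa using ht1)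
  rw [← (tendsto_ofReal_root hM ht).limsup_eq]
  exact limsup_le_limsup (.of_forall fun n => iSup_le fun i =>
    ENNReal.rpow_le_rpow (h n i) (by positivity))

theorem one_lt_liminf_iInf_root {ι : Type*} {F : ℕ → ι → ℝ≥0∞} {M t : ℝ} (hM : 0 < M)
    (ht : 1 < t) (h : ∀ n i, ENNReal.ofReal (M * t ^ n) ≤ F n i) :
    1 < liminf (fun n : ℕ => ⨅ i, F n i ^ (1 / (n : ℝ))) atTop := by
  refine lt_of_lt_of_le (b := ENNReal.ofReal t) (by simpa using ht) ?_
  rw [← (tendsto_ofReal_root hM (by linarith)).liminf_eq]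
  exact liminf_le_liminf (.of_forall fun n => le_iInf fun i =>
    ENNReal.rpow_le_rpow (h n i) (by positivity))

section Ratio

variable {x y : ℝ≥0∞} {M t q : ℝ} {n : ℕ}

/-- A comparison of the negative powers of two measures bounds their ratio. -/
theorem div_le_of_rpow_neg_le (hx0 : x ≠ 0) (hx : x ≠ ⊤) (hy0 : y ≠ 0) (hy : y ≠ ⊤) (hq : 0 < q)
    (hM : 0 < M) (ht : 0 < t)
    (h : y.toReal ^ (-q⁻¹) ≤ M * t ^ n * x.toReal ^ (-q⁻¹)) :
    x / y ≤ ENNReal.ofReal (M ^ q * (t ^ q) ^ n) := by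
  have hx' := ENNReal.toReal_pos hx0 hx
  have hy' := ENNReal.toReal_pos hy0 hy
  have key := Real.rpow_le_rpow (by positivity) h hq.le
  rw [Real.mul_rpow (by positivity) (by positivity), ← Real.rpow_mul hy'.le,
    ← Real.rpow_mul hx'.le, neg_mul, inv_mul_cancel₀ hq.ne', Real.rpow_neg_one,
    Real.rpow_neg_one, Real.mul_rpow hM.le (by positivity), ← Real.rpow_natCast t n,
    ← Real.rpow_mul ht.le, mul_comm (n : ℝ) q, Real.rpow_mul ht.le, Real.rpow_natCast] at key
  rw [← ENNReal.ofReal_toReal hx, ← ENNReal.ofReal_toReal hy, ← ENNReal.ofReal_div_of_pos hy']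
  refine ENNReal.ofReal_le_ofReal ?_
  rw [div_eq_mul_inv, ← le_div_iff₀' hx', div_eq_mul_inv]
  exact key

theorem le_div_of_rpow_neg_le (hx0 : x ≠ 0) (hx : x ≠ ⊤) (hy0 : y ≠ 0) (hy : y ≠ ⊤) (hq : 0 < q)
    (hM : 0 < M) (ht : 0 < t)
    (h : x.toReal ^ (-q⁻¹) ≤ M * t ^ n * y.toReal ^ (-q⁻¹)) :
    ENNReal.ofReal ((M ^ q)⁻¹ * ((t ^ q)⁻¹) ^ n) ≤ x / y := by
  have := ENNReal.inv_le_inv.2 (div_le_of_rpow_neg_le hy0 hy hx0 hx hq hM ht h)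
  rwa [ENNReal.inv_div (.inl hx) (.inl hx0), ← ENNReal.ofReal_inv_of_pos (by positivity), mul_inv,
    ← inv_pow] at this

end Ratio

/-! ### Iterates of the transformation -/

section Dynamics

variable {μ : Measure X} {f : Equiv.Perm X} {W : Set X}

theorem condStar_comp {g h : X → X} (hgm : Measurable g) (hg : CondStar μ g)
    (hh : CondStar μ h) : CondStar μ (g ∘ h) := by
  obtain ⟨c, hc, hc', H⟩ := hg
  obtain ⟨d, hd, hd', H'⟩ := hh
  refine ⟨d * c, ENNReal.mul_pos hd.ne' hc.ne', ENNReal.mul_ne_top hd' hc', fun B hB => ?_⟩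
  rw [preimage_comp, mul_assoc]
  exact (H' _ (hgm hB)).trans (by gcongr; exact H B hB)

theorem measurable_zpow_and_condStar_zpow (hf : Measurable f) (hf' : Measurable f.symm)
    (hs : CondStar μ f) (hs' : CondStar μ f.symm) (k : ℤ) :
    Measurable ⇑(f ^ k) ∧ CondStar μ ⇑(f ^ k) := by
  induction k with
  | zero => exact ⟨measurable_id, 1, by simp, by simp, fun B _ => by simp⟩
  | succ k ih =>
    rw [zpow_add_one, Equiv.Perm.coe_mul]
    exact ⟨ih.1.comp hf, condStar_comp ih.1 ih.2 hs⟩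
  | pred k ih =>
    rw [zpow_sub_one, Equiv.Perm.coe_mul]
    exact ⟨ih.1.comp hf', condStar_comp ih.1 ih.2 hs'⟩

theorem quasiMeasurePreserving_of_condStar {g : X → X} (hg : Measurable g)
    (hs : CondStar μ g) : Measure.QuasiMeasurePreserving g μ μ := by
  obtain ⟨c, -, -, H⟩ := hs
  refine ⟨hg, Measure.AbsolutelyContinuous.mk fun B hB h0 => ?_⟩
  rw [Measure.map_apply hg hB]
  simpa [h0] using H B hB

theorem img_eq_preimage {Y : Type*} (f : Equiv.Perm Y) (k : ℤ) (B : Set Y) :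
    img f k B = ⇑(f ^ (-k)) ⁻¹' B := by
  rw [img, zpow_neg]
  exact Equiv.image_eq_preimage_symm _ _

theorem IsDissipative.iterate (hd : IsDissipative μ f W) (hs : CondStar μ f)
    (hs' : CondStar μ f.symm) (k : ℤ) : Measurable ⇑(f ^ k) ∧ CondStar μ ⇑(f ^ k) :=
  measurable_zpow_and_condStar_zpow hd.meas_f hd.meas_symm hs hs' k

theorem IsDissipative.measurableSet_img (hd : IsDissipative μ f W) (hs : CondStar μ f)
    (hs' : CondStar μ f.symm) (k : ℤ) : MeasurableSet (img f k W) := by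
  rw [img_eq_preimage]
  exact (hd.iterate hs hs' _).1 hd.meas_W

theorem IsDissipative.measure_img_ne_top (hd : IsDissipative μ f W) (hs : CondStar μ f)
    (hs' : CondStar μ f.symm) (k : ℤ) : μ (img f k W) ≠ ⊤ := by
  obtain ⟨c, -, hc, H⟩ := (hd.iterate hs hs' (-k)).2
  rw [img_eq_preimage]
  exact ((H W hd.meas_W).trans_lt (ENNReal.mul_lt_top hc.lt_top hd.fin)).ne

theorem IsDissipative.measure_img_ne_zero (hd : IsDissipative μ f W) (hs : CondStar μ f)
    (hs' : CondStar μ f.symm) (k : ℤ) : μ (img f k W) ≠ 0 := by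
  obtain ⟨c, -, -, H⟩ := (hd.iterate hs hs' k).2
  intro h0
  have := H _ (hd.measurableSet_img hs hs' k)
  rw [h0, mul_zero, img, preimage_image_eq _ (f ^ k).injective] at this
  exact absurd this (by simpa using hd.pos.ne')

section Composition

variable {p : ℝ≥0∞} [Fact (1 ≤ p)] {T : Lp ℝ p μ ≃L[ℝ] Lp ℝ p μ}

theorem repsComp_zpow (hd : IsDissipative μ f W) (hs : CondStar μ f) (hs' : CondStar μ f.symm)
    (hT : RepsComp μ p f T) (n : ℤ) : RepsComp μ p ⇑(f ^ n) (T ^ n) := by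
  have qmp k := quasiMeasurePreserving_of_condStar (hd.iterate hs hs' k).1
    (hd.iterate hs hs' k).2
  have hq' : Measure.QuasiMeasurePreserving f.symm μ μ := by simpa using! qmp (-1)
  induction n with
  | zero => exact fun φ => .rfl
  | succ n ih =>
    intro φ
    rw [zpow_add_one, add_comm, zpow_one_add, Equiv.Perm.coe_mul]
    exact (ih (T φ)).trans ((qmp n).ae_eq_comp (hT φ))
  | pred n ih =>
    intro φ
    rw [zpow_sub_one, sub_eq_neg_add, zpow_add, zpow_neg_one, Equiv.Perm.coe_mul]
    refine (ih (T.symm φ)).trans ((qmp (-n)).ae_eq_comp (g' := fun x => φ (f.symm x)) ?_)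
    have h := hq'.ae_eq_comp (hT (T.symm φ))
    rw [T.apply_symm_apply] at h
    filter_upwards [h] with x hx
    simp only [comp_apply, Equiv.apply_symm_apply] at hx
    exact hx.symm

/-- A function whose `n`-th iterate is close to `s • 1_{f⁻ⁿ W}` is close to `s` on most of `W`. -/
theorem measure_far_from_const_le (hd : IsDissipative μ f W) (hs : CondStar μ f)
    (hs' : CondStar μ f.symm) (hp : p ≠ ⊤) {K : ℝ≥0∞} (hK0 : 0 < K) (hK : K ≠ ⊤)
    (hbd : BoundedDistortion μ f W K) (hT : RepsComp μ p f T) (y : Lp ℝ p μ) (k : ℤ) (s : ℝ)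
    (hy : ‖(T ^ (-k)) y - indicatorConstLp p (hd.measurableSet_img hs hs' k)
      (hd.measure_img_ne_top hs hs' k) s‖ < 1) {C : ℝ} (hC : 0 < C)
    (hCK : ENNReal.ofReal C = (3 * K) ^ p.toReal⁻¹) :
    μ {x ∈ W | C * (μ (img f k W)).toReal ^ (-p.toReal⁻¹) ≤ |y x - s|} ≤ μ W / 3 := by
  have hp0 : p ≠ 0 := (zero_lt_one.trans_le Fact.out).ne'
  have hq : 0 < p.toReal := ENNReal.toReal_pos hp0 hp
  have ha0 := hd.measure_img_ne_zero hs hs' k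
  have ha := hd.measure_img_ne_top hs hs' k
  have ham := hd.measurableSet_img hs hs' k
  set a := μ (img f k W) with hadef
  set c := C * a.toReal ^ (-p.toReal⁻¹) with hc
  set A := {x ∈ W | c ≤ |y x - s|} with hA
  have hAm : MeasurableSet A := hd.meas_W.inter (measurableSet_le measurable_const
    (((Lp.stronglyMeasurable y).measurable.sub_const s).abs))
  have hcp : ENNReal.ofReal c ^ p.toReal = 3 * K * a⁻¹ := by
    rw [hc, ENNReal.ofReal_mul hC.le, hCK, ENNReal.mul_rpow_of_nonneg _ _ hq.le,
      ← ENNReal.rpow_mul, inv_mul_cancel₀ hq.ne', ENNReal.rpow_one,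
      ← ENNReal.ofReal_rpow_of_pos (ENNReal.toReal_pos ha0 ha), ENNReal.ofReal_toReal ha,
      ← ENNReal.rpow_mul, neg_mul, inv_mul_cancel₀ hq.ne', ENNReal.rpow_neg_one]
  set d := (T ^ (-k)) y - indicatorConstLp p ham ha s with hdd
  have hsub : img f k A ≤ᵐ[μ] {x | ENNReal.ofReal c ≤ ‖d x‖₊} := by
    filter_upwards [Lp.coeFn_sub ((T ^ (-k)) y) (indicatorConstLp p ham ha s),
      repsComp_zpow hd hs hs' hT (-k) y,
      indicatorConstLp_coeFn (p := p) (hs := ham) (hμs := ha) (c := s)] with x h1 h2 h3 hx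
    have hxA : (f ^ (-k)) x ∈ A := by
      have : x ∈ img f k A := hx
      rwa [img_eq_preimage] at this
    have hxW : x ∈ img f k W := by
      rw [img_eq_preimage]
      exact hxA.1
    have : d x = y ((f ^ (-k)) x) - s := by
      rw [hdd, h1, Pi.sub_apply, h2, h3, indicator_of_mem hxW]
    change ENNReal.ofReal c ≤ ‖d x‖ₑ
    rw [this, Real.enorm_eq_ofReal_abs]
    exact ENNReal.ofReal_le_ofReal hxA.2
  have hcheb : 3 * K * a⁻¹ * μ (img f k A) ≤ 1 := by
    have h := mul_meas_ge_le_pow_eLpNorm' μ hp0 hp (Lp.aestronglyMeasurable d)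
      (ENNReal.ofReal c)
    have hd1 : eLpNorm d p μ ≤ 1 := by
      rw [← Lp.enorm_def, ← ofReal_norm]
      exact ENNReal.ofReal_le_one.2 hy.le
    rw [hcp] at h
    calc 3 * K * a⁻¹ * μ (img f k A) ≤ _ := mul_le_mul_right (measure_mono_ae hsub) _
      _ ≤ eLpNorm d p μ ^ p.toReal := h
      _ ≤ 1 := ENNReal.rpow_le_one hd1 hq.le
  have h1 := (hbd k A hAm fun x hx => hx.1).1
  rw [one_div, ENNReal.inv_mul_le_iff hK0.ne' hK] at h1
  rw [ENNReal.le_div_iff_mul_le (.inl (by simp)) (.inl (by simp))]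
  calc μ A * 3 = a⁻¹ * (a * μ A) * 3 := by
        rw [← mul_assoc, ENNReal.inv_mul_cancel ha0 ha, one_mul]
    _ ≤ a⁻¹ * (K * (μ (img f k A) * μ W)) * 3 := by gcongr
    _ = 3 * K * a⁻¹ * μ (img f k A) * μ W := by ring
    _ ≤ 1 * μ W := by gcongr
    _ = μ W := one_mul _

end Composition

/-- One-dimensional Helly theorem for closed intervals given by centres and radii. -/
theorem exists_abs_sub_le_of_pairwise {ι : Type*} [Nonempty ι] {s r : ι → ℝ}
    (h : ∀ i j, ∃ z, |z - s i| ≤ r i ∧ |z - s j| ≤ r j) : ∃ c, ∀ i, |c - s i| ≤ r i := by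
  have key i j : s i - r i ≤ s j + r j := by
    obtain ⟨z, h1, h2⟩ := h i j
    linarith [abs_le.1 h1, abs_le.1 h2]
  refine ⟨⨆ i, (s i - r i), fun j => abs_le.2 ⟨?_, ?_⟩⟩
  · have := le_ciSup (f := fun i => s i - r i) ⟨_, forall_mem_range.2 fun i => key i j⟩ j
    linarith
  · have := ciSup_le fun i => key i j
    linarith

end Dynamics

/-- Shadowing yields a solution of the scalar difference equation dominated by the weight. -/
theorem exists_bounded_solution_of_shadowing {μ : Measure X} {f : Equiv.Perm X} {W : Set X}
    {p : ℝ≥0∞} [Fact (1 ≤ p)] (hp : p ≠ ⊤) (hd : IsDissipative μ f W) {K : ℝ≥0∞} (hK0 : 0 < K)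
    (hK : K ≠ ⊤) (hbd : BoundedDistortion μ f W K) (hs : CondStar μ f)
    (hs' : CondStar μ f.symm) {T : Lp ℝ p μ ≃L[ℝ] Lp ℝ p μ} (hT : RepsComp μ p f T)
    (hsh : HasShadowing T) {b : ℤ → ℝ}
    (hbdef : ∀ j, b j = (μ (img f j W)).toReal ^ (-p.toReal⁻¹)) :
    ∃ (g : ℤ → ℝ) (D : ℝ), 0 < D ∧ (∀ j, g j - g (j + 1) = b j) ∧ ∀ j, |g j| ≤ D * b j := by
  have hp0 : p ≠ 0 := (zero_lt_one.trans_le Fact.out).ne'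
  have hq : 0 < p.toReal := ENNReal.toReal_pos hp0 hp
  have hm := hd.measurableSet_img hs hs'
  have ha := hd.measure_img_ne_top hs hs'
  have ha0 := hd.measure_img_ne_zero hs hs'
  have hb j : 0 < b j := by
    rw [hbdef]
    exact Real.rpow_pos_of_pos (ENNReal.toReal_pos (ha0 j) (ha j)) _
  obtain ⟨δ, hδ, H⟩ := hsh 1 one_pos
  obtain ⟨G, hG⟩ := exists_sub_succ_eq b
  let e (j : ℤ) (s : ℝ) : Lp ℝ p μ := indicatorConstLp p (hm j) (ha j) s
  have he (j : ℤ) (s : ℝ) : T (e j s) = e (j - 1) s := by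
    refine Lp.ext ?_
    have qmp := quasiMeasurePreserving_of_condStar hd.meas_f hs
    filter_upwards [hT (e j s), qmp.ae_eq_comp (indicatorConstLp_coeFn (p := p) (hs := hm j)
      (hμs := ha j) (c := s)), indicatorConstLp_coeFn (p := p) (hs := hm (j - 1))
      (hμs := ha (j - 1)) (c := s)] with x h1 h2 h3
    have hmem : f x ∈ img f j W ↔ x ∈ img f (j - 1) W := by
      rw [img_eq_preimage, img_eq_preimage, show -(j - 1) = -j + 1 by ring, zpow_add_one]
      rfl
    rw [h1, h3]
    refine Eq.trans h2 ?_
    by_cases hx : x ∈ img f (j - 1) W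
    · rw [indicator_of_mem hx, comp_apply, indicator_of_mem (hmem.2 hx)]
    · rw [indicator_of_notMem hx, comp_apply, indicator_of_notMem (mt hmem.1 hx)]
  obtain ⟨y, hy⟩ := H (fun n => e (-n) (δ * G (-n))) fun n => by
    rw [he, show -(n + 1) = -n - 1 by ring]
    have h1 := hG (-n - 1)
    rw [sub_add_cancel] at h1
    rw [indicatorConstLp_sub, norm_indicatorConstLp hp0 hp, ← mul_sub, norm_mul,
      norm_sub_rev, h1, Real.norm_of_nonneg hδ.le, Real.norm_of_nonneg (hb _).le, hbdef,
      one_div, mul_assoc, measureReal_def,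
      ← Real.rpow_add (ENNReal.toReal_pos (ha0 _) (ha _)), neg_add_cancel, Real.rpow_zero, mul_one]
  set C := ((3 * K) ^ p.toReal⁻¹).toReal with hCdef
  have h3K : (3 * K) ^ p.toReal⁻¹ ≠ ⊤ :=
    ENNReal.rpow_ne_top_of_nonneg (by positivity) (ENNReal.mul_ne_top (by simp) hK)
  have hCK : ENNReal.ofReal C = (3 * K) ^ p.toReal⁻¹ := ENNReal.ofReal_toReal h3K
  have hC : 0 < C := ENNReal.toReal_pos
    (ENNReal.rpow_pos (ENNReal.mul_pos (by simp) hK0.ne')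
      (ENNReal.mul_ne_top (by simp) hK)).ne' h3K
  have hfar (j : ℤ) : μ {x ∈ W | C * b j ≤ |y x - δ * G j|} ≤ μ W / 3 := by
    rw [hbdef]
    refine measure_far_from_const_le hd hs hs' hp hK0 hK hbd hT y j _ ?_ hC hCK
    simpa [e] using hy (-j)
  obtain ⟨c, hc⟩ := exists_abs_sub_le_of_pairwise (s := fun j => δ * G j)
    (r := fun j => C * b j) fun i j => by
      by_contra! hcon
      have hW : W ⊆ {x ∈ W | C * b i ≤ |y x - δ * G i|} ∪ {x ∈ W | C * b j ≤ |y x - δ * G j|} :=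
        fun x hx => by
          by_cases hxi : C * b i ≤ |y x - δ * G i|
          · exact .inl ⟨hx, hxi⟩
          · exact .inr ⟨hx, (hcon (y x) (not_le.1 hxi).le).le⟩
      have h1 : μ W ≤ μ W / 3 + μ W / 3 :=
        (measure_mono hW).trans ((measure_union_le _ _).trans (add_le_add (hfar i) (hfar j)))
      have h2 := ENNReal.toReal_pos hd.pos.ne' hd.fin.ne
      have h3 : μ W / 3 ≠ ⊤ := ENNReal.div_ne_top hd.fin.ne (by simp)
      have h4 := ENNReal.toReal_mono (ENNReal.add_ne_top.2 ⟨h3, h3⟩) h1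
      rw [ENNReal.toReal_add h3 h3, ENNReal.toReal_div] at h4
      norm_num at h4
      linarith
  refine ⟨fun j => G j - c / δ, C / δ, by positivity, fun j => by simp [← hG j], fun j => ?_⟩
  have h := hc j
  have h1 : G j - c / δ = -(c - δ * G j) / δ := by field_simp; ring
  dsimp only
  rw [h1, abs_div, abs_neg, abs_of_pos hδ, div_mul_eq_mul_div]
  gcongr

/-- Theorem SN, Shadowing Necessity: if the composition operator `T_f`
has the shadowing property, then one of conditions 𝓗𝓒, 𝓗𝓓, 𝓖𝓗 holds. -/
theorem condHC_or_condHD_or_condGH_of_shadowing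
    {X : Type*} [MeasurableSpace X] (μ : Measure X) (f : Equiv.Perm X) (W : Set X)
    (p : ℝ≥0∞) [Fact (1 ≤ p)] (hp : p ≠ ⊤)
    (hdiss : IsDissipative μ f W)
    (K : ℝ≥0∞) (hK0 : 0 < K) (hKfin : K ≠ ⊤)
    (hbd : BoundedDistortion μ f W K)
    (hstar : CondStar μ f) (hstar' : CondStar μ f.symm)
    (T : Lp ℝ p μ ≃L[ℝ] Lp ℝ p μ) (hT : RepsComp μ p f T)
    (hsh : HasShadowing T) :
    CondHC μ f W ∨ CondHD μ f W ∨ CondGH μ f W := by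
  have hq : 0 < p.toReal := ENNReal.toReal_pos (zero_lt_one.trans_le Fact.out).ne' hp
  have ha0 := hdiss.measure_img_ne_zero hstar hstar'
  have ha := hdiss.measure_img_ne_top hstar hstar'
  let b : ℤ → ℝ := fun j => (μ (img f j W)).toReal ^ (-p.toReal⁻¹)
  have hb j : 0 < b j := Real.rpow_pos_of_pos (ENNReal.toReal_pos (ha0 j) (ha j)) _
  obtain ⟨g, D, hD, hg, hgD⟩ := exists_bounded_solution_of_shadowing hp hdiss hK0 hKfin hbd
    hstar hstar' hT hsh (b := b) fun _ => rfl
  have decay {M t : ℝ} (hM : 0 < M) (ht : 0 < t) (j : ℤ) (n : ℕ)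
      (h : b (j + n) ≤ M * t ^ n * b j) :=
    div_le_of_rpow_neg_le (ha0 j) (ha j) (ha0 _) (ha _) hq hM ht h
  have growth {M t : ℝ} (hM : 0 < M) (ht : 0 < t) (j : ℤ) (n : ℕ)
      (h : b j ≤ M * t ^ n * b (j + n)) :=
    le_div_of_rpow_neg_le (ha0 j) (ha j) (ha0 _) (ha _) hq hM ht h
  rcases weight_trichotomy hb hg hD hgD with ⟨M, t, hM, ht, ht1, h⟩ | ⟨M, t, hM, ht, ht1, h⟩ |
    ⟨⟨M, t, hM, ht, ht1, h⟩, M', t', hM', ht', ht1', h'⟩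
  · exact .inl (limsup_iSup_root_lt_one (by positivity) (by positivity)
      (Real.rpow_lt_one ht.le ht1 hq) fun n j => decay hM ht j n (h j n))
  · exact .inr (.inl (one_lt_liminf_iInf_root (by positivity)
      ((one_lt_inv₀ (by positivity)).2 (Real.rpow_lt_one ht.le ht1 hq))
      fun n j => growth hM ht j n (h j n)))
  · refine .inr (.inr ⟨limsup_iSup_root_lt_one (M := M ^ p.toReal) (by positivity)
      (by positivity) (Real.rpow_lt_one ht.le ht1 hq) fun n m => ?_,
      one_lt_liminf_iInf_root (M := (M' ^ p.toReal)⁻¹) (by positivity)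
      ((one_lt_inv₀ (by positivity)).2 (Real.rpow_lt_one ht'.le ht1' hq))
      fun n m => growth hM' ht' m n (h' m n (by positivity))⟩)
    have := decay hM ht (-m - n) n (h _ n (by omega))
    rwa [sub_add_cancel] at this

end GHShadow
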